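/- The emptiness problem for PAFAs is undecidable: there is no total computable function (with respect to a natural effective encoding of PAFAs, e.g., with all finite sets given as Fin k) that, given a PAFA A, decides whether the language of A is empty. -/

import Mathlib

/-!
A realtime private alternating finite automaton (PAFA) over input alphabet `α`.

* Common state components: `Fin kc`; private state components: `Fin kp`.
* Public game alphabet Γ = `Fin g`, private game alphabet Δ = `Fin d` (they are disjoint by
  construction, being the two summands of `Fin g ⊕ Fin d`), each of size at least 2.
* Tape symbols: `Option α`, with `none` the end-marker ¢.
* The transition functions return either a single successor (`Sum.inl`, a non-branching move)
  or a family of successors indexed by the relevant game alphabet (`Sum.inr`, a branching move).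
* Successors of universal branching moves indexed by public symbols must keep the private
  component unchanged.
* On input `w`, the automaton processes ¢ w ¢, making two transitions per tape symbol; this is
  realized by listing every tape symbol twice, one occurrence per transition.
-/
structure PAFA (α : Type) where
  kc : ℕ
  kp : ℕ
  g : ℕ
  d : ℕ
  g_ge : 2 ≤ g
  d_ge : 2 ≤ d
  /-- the set of universal states (`true` = universal; the rest are existential) -/
  isUniv : Fin kc × Fin kp → Bool
  /-- existential transition function: depends only on the common component, and yields either
  a single successor common component or a family indexed by Γ -/
  δE : Fin kc → Fin kc ⊕ (Fin g → Fin kc)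
  /-- universal transition function: yields either a single successor state or a family
  indexed by Γ ⊕ Δ -/
  δU : Fin kc × Fin kp → Option α → (Fin kc × Fin kp) ⊕ ((Fin g ⊕ Fin d) → Fin kc × Fin kp)
  /-- successors of universal branching moves indexed by public symbols have private component
  equal to the current one -/
  pub_private : ∀ s σ fam, δU s σ = Sum.inr fam → ∀ γ : Fin g, (fam (Sum.inl γ)).2 = s.2
  /-- the initial state (s_{c0}, s_{p0}) -/
  init : Fin kc × Fin kp
  /-- the accepting common component q_a -/
  qa : Fin kc

namespace PAFA

variable {α : Type} (A : PAFA α)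

/-- An existential strategy: assigns a public game symbol to each pair of a common state
component and a finite sequence over Γ (the public moves seen so far). -/
abbrev Strategy := Fin A.kc × List (Fin A.g) → Fin A.g

/-- One transition from state `st` with public-move history `h`, reading tape symbol `σ`:
existential branchings are resolved by the strategy `f`, universal branchings are resolved in
all possible ways, and `P` is the property required of each successor (together with its
updated history).  Non-branching moves do not count as moves and leave the history unchanged;
branching moves labeled by public symbols (existential moves and public universal moves)
append their Γ-label to the history; private universal moves leave it unchanged. -/
def Step (f : A.Strategy) (σ : Option α) (st : Fin A.kc × Fin A.kp)
    (h : List (Fin A.g)) (P : Fin A.kc × Fin A.kp → List (Fin A.g) → Prop) : Prop :=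
  if A.isUniv st then
    match A.δU st σ with
    | Sum.inl s' => P s' h
    | Sum.inr fam =>
        (∀ γ : Fin A.g, P (fam (Sum.inl γ)) (h ++ [γ])) ∧
        (∀ δ' : Fin A.d, P (fam (Sum.inr δ')) h)
  else
    match A.δE st.1 with
    | Sum.inl c' => P (c', st.2) h
    | Sum.inr fam => P (fam (f (st.1, h)), st.2) (h ++ [f (st.1, h)])

/-- All computation paths consistent with strategy `f`, starting from state `st` with
public-move history `h` and the given remaining tape (each tape symbol occurring twice, one
occurrence per transition), end in a state whose common component is `A.qa`. -/
def Acc (f : A.Strategy) : List (Option α) → Fin A.kc × Fin A.kp → List (Fin A.g) → Prop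
  | [], st, _ => st.1 = A.qa
  | σ :: rest, st, h => A.Step f σ st h fun st' h' => Acc f rest st' h'

/-- The tape ¢ w ¢ with every tape symbol listed twice (two transitions per tape symbol);
`none` is the end-marker ¢. -/
def tape (w : List α) : List (Option α) :=
  (none :: (w.map some) ++ [none]).flatMap fun σ => [σ, σ]

/-- `A` accepts `w` iff there is an existential strategy under which every consistent
computation path ends in a state with accepting common component. -/
def Accepts (w : List α) : Prop :=
  ∃ f : A.Strategy, A.Acc f (tape w) A.init []

/-- The language of `A`. -/
def lang : Set (List α) := { w | A.Accepts w }

end PAFA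

/-- The underlying data of a PAFA over the alphabet `Fin a` (everything except the `Prop`-valued
fields, which do not influence the language), as a plain encodable type. -/
def PAFAData (a : ℕ) : Type :=
  Σ kc : ℕ, Σ kp : ℕ, Σ g : ℕ, Σ d : ℕ,
    ((Fin kc × Fin kp) → Bool) ×
    (Fin kc → Fin kc ⊕ (Fin g → Fin kc)) ×
    ((Fin kc × Fin kp) → Option (Fin a) →
      ((Fin kc × Fin kp) ⊕ ((Fin g ⊕ Fin d) → Fin kc × Fin kp))) ×
    (Fin kc × Fin kp) × Fin kc

instance (a : ℕ) : Encodable (PAFAData a) := by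
  unfold PAFAData; infer_instance

/-- A natural effective encoding of PAFAs over the alphabet `Fin a` as natural numbers, via
the canonical `Encodable` instance on the underlying data. -/
def PAFA.encode {a : ℕ} (A : PAFA (Fin a)) : ℕ :=
  Encodable.encode
    (⟨A.kc, A.kp, A.g, A.d, A.isUniv, A.δE, A.δU, A.init, A.qa⟩ : PAFAData a)

open Turing in
theorem trNat_two_pow (n : ℕ) :
    PartrecToTM2.trNat (2 ^ n) = List.replicate n .bit0 ++ [.bit1] := by
  have key : ∃ p : PosNum, ((2 ^ n : ℕ) : Num) = Num.pos p ∧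
      PartrecToTM2.trPosNum p = List.replicate n .bit0 ++ [.bit1] := by
    induction n with
    | zero => exact ⟨PosNum.one, by simp; rfl, rfl⟩
    | succ n ih =>
      obtain ⟨p, hp, hp'⟩ := ih
      refine ⟨p.bit0, ?_, by simp [PartrecToTM2.trPosNum, hp', List.replicate_succ]⟩
      have h := Num.ofNat'_bit false (2 ^ n)
      rw [Num.ofNat'_eq, Num.ofNat'_eq, hp] at h
      rw [pow_succ, mul_comm]
      simpa [Nat.bit, Num.bit0] using h
  obtain ⟨p, hp, hp'⟩ := key
  rw [PartrecToTM2.trNat, hp, PartrecToTM2.trNum, hp']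

theorem exists_partrec_halting_two_pow :
    ∃ g : ℕ →. ℕ, Nat.Partrec g ∧
      ∀ n, (g (2 ^ n)).Dom ↔ ((Nat.Partrec.Code.ofNatCode n).eval 0).Dom := by
  have hpow : Primrec fun n : ℕ => 2 ^ n :=
    (Primrec.nat_rec₁ 1 (Primrec.nat_mul.comp .snd (.const 2)).to₂).of_eq fun n => by
      induction n with
      | zero => rfl
      | succ n ih => simp_all [pow_succ]
  have hdec : Computable₂ fun m k : ℕ => decide (2 ^ k = m) :=
    (Primrec.beq.comp (hpow.comp .snd) .fst).to_comp.to₂.of_eq fun x => by simp [beq_eq_decide]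
  have hfind : Partrec fun m : ℕ => Nat.rfind fun k => Part.some (decide (2 ^ k = m)) :=
    Partrec.rfind hdec.partrec₂
  have hev : Partrec₂ fun (_ k : ℕ) => (Denumerable.ofNat Nat.Partrec.Code k).eval 0 :=
    Nat.Partrec.Code.eval_part.comp ((Computable.ofNat _).comp .snd) (.const 0)
  refine ⟨_, Partrec.nat_iff.1 (hfind.bind hev), fun n => ?_⟩
  have h : (Nat.rfind fun k => Part.some (decide (2 ^ k = 2 ^ n))) = Part.some n := by
    refine Part.eq_some_iff.2 (Nat.mem_rfind.2 ⟨by simp, fun hm => ?_⟩)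
    simpa using fun h => hm.ne (Nat.pow_right_injective le_rfl h)
  rw [h, Part.bind_some]
  rfl

open Turing in
theorem exists_fintype_machine (g : ℕ →. ℕ) (hg : Nat.Partrec g) :
    ∃ (Γ Λ : Type) (_ : Inhabited Γ) (_ : Fintype Γ) (_ : Inhabited Λ) (_ : Fintype Λ)
      (M : TM0.Machine Γ Λ) (x y z : Γ), ∀ n,
      (StateTransition.eval (TM0.step M) (TM0.init (x :: y :: List.replicate n z))).Dom ↔
        (g (2 ^ n)).Dom := by
  classical
  obtain ⟨c, hc⟩ := ToPartrec.Code.exists_code (Nat.Partrec'.part_iff₁.2 (Partrec.nat_iff.2 hg))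
  let : Fintype PartrecToTM2.K' := ⟨{.main, .rev, .aux, .stack}, fun x => by cases x <;> simp⟩
  let : Inhabited PartrecToTM2.Λ' := ⟨PartrecToTM2.trNormal c .halt⟩
  let M1 := TM2to1.tr PartrecToTM2.tr
  let M0 := TM1to0.tr M1
  have hs : TM0.Supports M0 _ :=
    TM1to0.tr_supports M1 (TM2to1.tr_supports _ (PartrecToTM2.tr_supports c .halt))
  generalize (TM1to0.trStmts M1 (TM2to1.trSupp PartrecToTM2.tr
    (PartrecToTM2.codeSupp c .halt))) = S at hs
  have hd : default ∈ S := hs.1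
  let : Inhabited {q // q ∈ S} := ⟨⟨default, hd⟩⟩
  let f : PointedMap (TM2to1.Γ' PartrecToTM2.K' fun _ => PartrecToTM2.Γ')
    (TM2to1.Γ' PartrecToTM2.K' fun _ => PartrecToTM2.Γ') := ⟨id, rfl⟩
  let g₁ : PointedMap (TM1to0.Λ' M1) {q // q ∈ S} :=
    ⟨fun q => if h : q ∈ S then ⟨q, h⟩ else default, by rw [dif_pos hd]; rfl⟩
  have hr := TM0.Machine.map_respects M0 f f g₁ (fun q => q.1) hs (fun _ => rfl)
    (fun q hq => by
      change (if h : q ∈ S then (⟨q, h⟩ : {q // q ∈ S}) else default).1 = q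
      rw [dif_pos (Finset.mem_coe.1 hq)])
  let cell (a : PartrecToTM2.Γ') : PartrecToTM2.K' → Option PartrecToTM2.Γ' :=
    Function.update (fun _ => none) PartrecToTM2.K'.main (some a)
  refine ⟨TM2to1.Γ' PartrecToTM2.K' fun _ => PartrecToTM2.Γ', {q // q ∈ S}, inferInstance,
    inferInstance, inferInstance, inferInstance, M0.map f f g₁ (fun q => q.1),
    (true, cell .cons), (false, cell .bit1), (false, cell .bit0), fun n => ?_⟩
  have h0 := StateTransition.tr_eval_dom hr (a₁ := TM0.init ((true, cell .cons) ::
    (false, cell .bit1) :: List.replicate n (false, cell .bit0))) ⟨hs.1, rfl⟩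
  rw [TM0.map_init, show f.f = id from rfl, List.map_id] at h0
  rw [h0]
  have hinit : TM2to1.trInit PartrecToTM2.K'.main (PartrecToTM2.trList [2 ^ n]) =
      (true, cell .cons) :: (false, cell .bit1) :: List.replicate n (false, cell .bit0) := by
    simp only [TM2to1.trInit, PartrecToTM2.trList, trNat_two_pow]
    simp only [List.append_assoc, List.reverse_append, List.reverse_cons,
      List.reverse_replicate, List.cons_append, List.nil_append, List.reverse_nil]
    exact congrArg (fun l => _ :: _ :: l) (List.map_replicate ..)
  have h1 : (TM0.eval M0 (TM2to1.trInit PartrecToTM2.K'.main (PartrecToTM2.trList [2 ^ n]))).Dom ↔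
      (TM2.eval PartrecToTM2.tr PartrecToTM2.K'.main (PartrecToTM2.trList [2 ^ n])).Dom := by
    rw [TM1to0.tr_eval]
    exact TM2to1.tr_eval_dom PartrecToTM2.tr PartrecToTM2.K'.main (PartrecToTM2.trList [2 ^ n])
  rw [hinit] at h1
  refine Iff.trans h1 ?_
  have h2 := PartrecToTM2.tr_eval c [2 ^ n]
  have h3 : TM2.init PartrecToTM2.K'.main (PartrecToTM2.trList [2 ^ n]) =
      PartrecToTM2.init c [2 ^ n] := by
    unfold TM2.init PartrecToTM2.init
    congr 1
    funext k
    cases k <;> rfl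
  change (StateTransition.eval (TM2.step PartrecToTM2.tr) _).Dom ↔ _
  rw [h3, h2]
  have h4 := hc ⟨[2 ^ n], rfl⟩
  simp only at h4
  rw [h4]
  rfl

open Turing in
theorem exists_undecidable_machine :
    ∃ (Γ Λ : Type) (_ : Inhabited Γ) (_ : Fintype Γ) (_ : Inhabited Λ) (_ : Fintype Λ)
      (M : TM0.Machine Γ Λ) (x y z : Γ), ¬ ∃ f : ℕ → Bool, Computable f ∧ ∀ n, f n = true ↔
        ¬ (StateTransition.eval (TM0.step M) (TM0.init (x :: y :: List.replicate n z))).Dom := by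
  obtain ⟨g, hg, hgn⟩ := exists_partrec_halting_two_pow
  obtain ⟨Γ, Λ, i₁, i₂, i₃, i₄, M, x, y, z, h⟩ := exists_fintype_machine g hg
  refine ⟨Γ, Λ, i₁, i₂, i₃, i₄, M, x, y, z, fun ⟨f, hf, hfn⟩ => ?_⟩
  refine ComputablePred.halting_problem 0 (ComputablePred.computable_iff.2
    ⟨fun c => !f (Encodable.encode c), ?_, ?_⟩)
  · exact Primrec.not.to_comp.comp (hf.comp .encode)
  · funext c
    have := hfn (Encodable.encode c)
    rw [h, hgn] at this
    have hc : Nat.Partrec.Code.ofNatCode (Encodable.encode c) = c :=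
      Denumerable.ofNat_encode c
    rw [hc] at this
    simp only [Bool.not_eq_true', ← Bool.not_eq_true, this, not_not]

section

open Encodable

theorem encode_list_map {α β : Type*} [Encodable β] (g : α → β) (l : List α) :
    encode (l.map g) = encode (l.map fun x => encode (g x)) := by
  induction l with
  | nil => rfl
  | cons a l ih => rw [List.map_cons, List.map_cons, encode_list_cons, ih]; rfl

theorem encode_finArrow {n : ℕ} {β : Type*} [Encodable β] (F : Fin n → β) :
    @encode _ finArrow F = encode (List.ofFn F) := by
  rw [finArrow, encode_ofEquiv, ← List.Vector.toList_ofFn]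
  rfl

theorem encode_finPi {n : ℕ} {β : Type*} [Encodable β] (F : Fin n → β) :
    @encode _ (finPi n fun _ => β) F =
      encode (List.ofFn fun i => Nat.pair i (encode (F i))) := by
  have h : @encode _ (finPi n fun _ => β) F =
      @encode _ finArrow fun i : Fin n => (⟨i, F i⟩ : Σ _ : Fin n, β) := rfl
  rw [h, encode_finArrow]
  rw [List.ofFn_eq_map, List.ofFn_eq_map, encode_list_map]
  rfl

theorem coe_cast_fin {a b : ℕ} (h : a = b) (x : Fin a) :
    (Equiv.cast (congrArg Fin h) x).val = x.val := by
  subst h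
  rfl

/-- The code of a function, given the list of the codes of its values. -/
def graphCode (l : List ℕ) : ℕ :=
  encode ((List.range l.length).map fun i => Nat.pair i (l.getD i 0))

theorem encode_fintypeArrow {D β : Type*} [Encodable D] [Fintype D] [Encodable β] (F : D → β) :
    @encode _ fintypeArrowOfEncodable F =
      graphCode ((sortedUniv D).map fun x => encode (F x)) := by
  rw [fintypeArrowOfEncodable, encode_ofEquiv]
  refine (encode_finPi (fun i => F (fintypeEquivFin.symm i))).trans ?_
  rw [graphCode]
  congr 1
  refine List.ext_getElem (by simp) fun i h₁ h₂ => ?_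
  simp only [List.length_map, List.length_range, length_sortedUniv] at h₂
  simp only [List.getElem_ofFn, List.getElem_map, List.getElem_range]
  rw [List.getD_eq_getElem _ _ (by simpa using h₂), List.getElem_map]
  congr 3
  rw [Equiv.symm_apply_eq]
  ext
  refine Eq.trans ?_ (coe_cast_fin (length_sortedUniv D) _).symm
  simp [List.Nodup.idxOf_getElem]

theorem sortedUniv_fin_prod (k l : ℕ) :
    (sortedUniv (Fin k × Fin l)).map encode =
      (List.range (Nat.pair k l)).filter fun m => decide (m.unpair.1 < k ∧ m.unpair.2 < l) := by
  have hcode : ∀ (i : Fin k) (j : Fin l), encode (i, j) = Nat.pair i j := fun _ _ => rfl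
  refine List.Perm.eq_of_pairwise (le := (· ≤ ·)) (fun _ _ _ _ => le_antisymm) ?_ ?_
    ((List.perm_ext_iff_of_nodup ((sortedUniv_nodup _).map encode_injective)
      (List.nodup_range.filter _)).2 fun m => ?_)
  · exact List.pairwise_map.2
      (Finset.pairwise_sort Finset.univ (encode' (Fin k × Fin l) ⁻¹'o (· ≤ ·)))
  · exact (List.pairwise_lt_range.imp le_of_lt).filter _
  · simp only [List.mem_map, mem_sortedUniv, true_and, List.mem_filter, List.mem_range,
      decide_eq_true_eq]
    constructor
    · rintro ⟨⟨i, j⟩, rfl⟩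
      rw [hcode, Nat.unpair_pair]
      exact ⟨(Nat.pair_lt_pair_left _ i.2).trans (Nat.pair_lt_pair_right _ j.2), i.2, j.2⟩
    · rintro ⟨-, h₁, h₂⟩
      exact ⟨(⟨_, h₁⟩, ⟨_, h₂⟩), by rw [hcode]; exact Nat.pair_unpair m⟩

theorem primrec_graphCode : Primrec graphCode :=
  Primrec.encode.comp (Primrec.list_map (Primrec.list_range.comp Primrec.list_length)
    (Primrec₂.natPair.comp .snd ((Primrec.list_getD 0).comp .fst .snd)).to₂)

theorem primrec_list_map_family {ι α β : Type*} [Primcodable α] [Primcodable β] (F : ι → α → β)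
    (hF : ∀ i, Primrec (F i)) (l : List ι) : Primrec fun x => l.map fun i => F i x := by
  induction l with
  | nil => exact .const []
  | cons i l ih => exact Primrec.list_cons.comp (hF i) ih

theorem primrec_finite_lookup {k : ℕ} (v : Fin k → ℕ → ℕ) (hv : ∀ i, Primrec (v i)) :
    ∃ V : ℕ → ℕ → ℕ, Primrec₂ V ∧ ∀ (i : Fin k) x, V i x = v i x := by
  refine ⟨fun i x => ((List.finRange k).map fun j => v j x).getD i 0,
    ((Primrec.list_getD 0).comp ((primrec_list_map_family v hv _).comp .snd) .fst).to₂,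
    fun i x => ?_⟩
  simp

theorem primrec_encode_prod_fun {k l : ℕ} {β : ℕ → Type} [∀ n, Encodable (β n)]
    (F : ∀ n, Fin k × Fin (l + n) → β n) (v : Fin k → ℕ → ℕ) (hv : ∀ c, Primrec (v c))
    (h : ∀ n c p, encode (F n (c, p)) = v c p) :
    Primrec fun n => @encode _ fintypeArrowOfEncodable (F n) := by
  obtain ⟨V, hV, hVv⟩ := primrec_finite_lookup v hv
  have hlist : ∀ n, ((sortedUniv (Fin k × Fin (l + n))).map fun x => encode (F n x)) =
      (List.range (Nat.pair k (l + n))).filterMap fun m =>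
        if m.unpair.1 < k ∧ m.unpair.2 < l + n then some (V m.unpair.1 m.unpair.2) else none := by
    intro n
    have hF : (fun x => encode (F n x)) =
        (fun m => V m.unpair.1 m.unpair.2) ∘ (encode : Fin k × Fin (l + n) → ℕ) := by
      funext ⟨c, p⟩
      have hcode : encode (c, p) = Nat.pair c p := rfl
      rw [Function.comp_apply, hcode, Nat.unpair_pair, h, hVv]
    rw [hF, ← List.map_map, sortedUniv_fin_prod, ← List.filterMap_eq_map,
      ← List.filterMap_eq_filter, List.filterMap_filterMap]
    refine congrArg (fun f => List.filterMap f _) (funext fun m => ?_)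
    by_cases hm : m.unpair.1 < k ∧ m.unpair.2 < l + n <;> simp [Option.guard, hm]
  have hpair : Primrec fun n => Nat.pair k (l + n) :=
    Primrec₂.natPair.comp (.const k) (Primrec.nat_add.comp (.const l) .id)
  refine (primrec_graphCode.comp (Primrec.listFilterMap (Primrec.list_range.comp hpair)
    (g := fun n m => if m.unpair.1 < k ∧ m.unpair.2 < l + n then
      some (V m.unpair.1 m.unpair.2) else none) ?_)).of_eq fun n => ?_
  · have h₁ : Primrec fun x : ℕ × ℕ => x.2.unpair.1 := Primrec.fst.comp (Primrec.unpair.comp .snd)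
    have h₂ : Primrec fun x : ℕ × ℕ => x.2.unpair.2 := Primrec.snd.comp (Primrec.unpair.comp .snd)
    exact (Primrec.ite (.and (Primrec.nat_lt.comp h₁ (.const k))
      (Primrec.nat_lt.comp h₂ (Primrec.nat_add.comp (.const l) .fst)))
      (Primrec.option_some.comp (hV.comp h₁ h₂)) (.const none)).to₂
  · rw [encode_fintypeArrow, hlist]

theorem encode_pafa_eq {a : ℕ} (A : PAFA (Fin a)) :
    A.encode = Nat.pair A.kc (Nat.pair A.kp (Nat.pair A.g (Nat.pair A.d (Nat.pair
      (encode A.isUniv) (Nat.pair (encode A.δE) (Nat.pair (encode A.δU)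
        (Nat.pair (encode A.init) (encode A.qa)))))))) := by
  have : A.encode = @encode (Σ kc : ℕ, Σ kp : ℕ, Σ g : ℕ, Σ d : ℕ,
    ((Fin kc × Fin kp) → Bool) ×
    (Fin kc → Fin kc ⊕ (Fin g → Fin kc)) ×
    ((Fin kc × Fin kp) → Option (Fin a) →
      ((Fin kc × Fin kp) ⊕ ((Fin g ⊕ Fin d) → Fin kc × Fin kp))) ×
    (Fin kc × Fin kp) × Fin kc) _ ⟨A.kc, A.kp, A.g, A.d, A.isUniv, A.δE, A.δU, A.init, A.qa⟩ := rfl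
  rw [this]
  simp only [encode_sigma_val, encode_prod_val, encode_nat]

/-- An update of the private component: keep it, decrement it as a counter, or set it to one of
finitely many designated values. -/
inductive PrivMove (Q : Type)
  | keep
  | dec
  | to (j : Q)

/-- A uniform description of a family of PAFAs indexed by a number `n`. The private components are
the elements of `Q` together with a counter ranging over `0, …, n`, and the universal transitions
depend on the counter only through its being positive. The existential states are determined by
their common component. -/
structure CounterTable (L C Q : Type) where
  /-- the successors of an existential common component -/
  ask : C → Option (L → C)
  /-- the universal transitions -/
  next : C → Q ⊕ Bool → Option L →
    (C × PrivMove Q) ⊕ ((L → C) × (C × PrivMove Q) × (C × PrivMove Q))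
  start : C
  acc : C

namespace CounterTable

variable {L C Q : Type} (T : CounterTable L C Q)

section

variable {q : ℕ} (eQ : Q ≃ Fin q)

/-- The information on a private component available to the universal transitions. -/
def view (p : ℕ) : Q ⊕ Bool :=
  if h : p < q then .inl (eQ.symm ⟨p, h⟩) else .inr (decide (q < p))

/-- The private component after an update. -/
def move (p : ℕ) : PrivMove Q → ℕ
  | .keep => p
  | .dec => p - 1
  | .to j => eQ j

theorem move_lt {n p : ℕ} (hp : p < q + 1 + n) (m : PrivMove Q) : move eQ p m < q + 1 + n := by
  cases m <;> simp only [move] <;> omega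

theorem primrec_move (m : PrivMove Q) : Primrec fun p => move eQ p m := by
  cases m
  · exact .id
  · exact Primrec.pred
  · exact .const _

end

variable {a k q : ℕ} (eL : L ≃ Fin a) (eC : C ≃ Fin k) (eQ : Q ≃ Fin q)

/-- A state of the `n`-th automaton. -/
def state (n : ℕ) (p : Fin (q + 1 + n)) (x : C × PrivMove Q) : Fin k × Fin (q + 1 + n) :=
  (eC x.1, ⟨move eQ p x.2, move_lt eQ p.2 x.2⟩)

/-- The `n`-th automaton of the family. -/
def pafa (ha : 2 ≤ a) (n : ℕ) : PAFA (Fin a) where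
  kc := k
  kp := q + 1 + n
  g := a
  d := 2
  g_ge := ha
  d_ge := le_rfl
  isUniv s := (T.ask (eC.symm s.1)).isNone
  δE c := match T.ask (eC.symm c) with
    | none => .inl c
    | some G => .inr fun γ => eC (G (eL.symm γ))
  δU s σ := match T.next (eC.symm s.1) (view eQ s.2) (σ.map eL.symm) with
    | .inl x => .inl (state eC eQ n s.2 x)
    | .inr (G, x, y) => .inr (Sum.elim (fun γ => (eC (G (eL.symm γ)), s.2))
        fun δ => if δ = 0 then state eC eQ n s.2 x else state eC eQ n s.2 y)
  pub_private s σ fam h γ := by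
    split at h
    · cases h
    · cases h
      rfl
  init := (eC T.start, ⟨q + n, by omega⟩)
  qa := eC T.acc

/-- The code of a universal transition. -/
def transitionCode (p : ℕ) :
    (C × PrivMove Q) ⊕ ((L → C) × (C × PrivMove Q) × (C × PrivMove Q)) → ℕ
  | .inl x => 2 * Nat.pair (eC x.1) (move eQ p x.2)
  | .inr (G, x, y) => 2 * graphCode ((sortedUniv (Fin a ⊕ Fin 2)).map
      (Sum.elim (fun γ => Nat.pair (eC (G (eL.symm γ))) p)
        fun δ => if δ = 0 then Nat.pair (eC x.1) (move eQ p x.2) else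
          Nat.pair (eC y.1) (move eQ p y.2))) + 1

theorem primrec_transitionCode
    (t : (C × PrivMove Q) ⊕ ((L → C) × (C × PrivMove Q) × (C × PrivMove Q))) :
    Primrec fun p => transitionCode eL eC eQ p t := by
  have hst : ∀ x : C × PrivMove Q, Primrec fun p => Nat.pair (eC x.1) (move eQ p x.2) := fun x =>
    Primrec₂.natPair.comp (.const _) (primrec_move eQ x.2)
  rcases t with x | ⟨G, x, y⟩
  · exact Primrec.nat_mul.comp (.const 2) (hst x)
  · refine Primrec.succ.comp (Primrec.nat_mul.comp (.const 2) (primrec_graphCode.comp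
      (primrec_list_map_family (fun (e : Fin a ⊕ Fin 2) p => Sum.elim
        (fun γ => Nat.pair (eC (G (eL.symm γ))) p)
        (fun δ => if δ = 0 then Nat.pair (eC x.1) (move eQ p x.2) else
          Nat.pair (eC y.1) (move eQ p y.2)) e) ?_ _)))
    rintro (γ | δ)
    · exact Primrec₂.natPair.comp (.const _) .id
    · by_cases hδ : δ = 0
      · simpa [hδ] using hst x
      · simpa [hδ] using hst y

theorem encode_δU (ha : 2 ≤ a) (n : ℕ) (c : Fin k) (p : Fin (q + 1 + n)) (σ : Option (Fin a)) :
    @encode ((Fin k × Fin (q + 1 + n)) ⊕ ((Fin a ⊕ Fin 2) → Fin k × Fin (q + 1 + n))) _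
        ((T.pafa eL eC eQ ha n).δU (c, p) σ) =
      transitionCode eL eC eQ p (T.next (eC.symm c) (view eQ p) (σ.map eL.symm)) := by
  change encode (match T.next (eC.symm c) (view eQ p) (σ.map eL.symm) with
    | .inl x => Sum.inl (state eC eQ n p x)
    | .inr (G, x, y) => .inr (Sum.elim (fun γ => (eC (G (eL.symm γ)), p))
        fun δ => if δ = (0 : Fin 2) then state eC eQ n p x else state eC eQ n p y)) = _
  rcases T.next (eC.symm c) (view eQ p) (σ.map eL.symm) with x | ⟨G, x, y⟩
  · rfl
  · refine (encode_inr _).trans ?_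
    rw [transitionCode, encode_fintypeArrow]
    congr 4
    funext e
    rcases e with γ | δ
    · rfl
    · by_cases hδ : δ = 0
      · simp only [Sum.elim_inr, if_pos hδ]
        rfl
      · simp only [Sum.elim_inr, if_neg hδ]
        rfl

theorem primrec_of_view (W : Q ⊕ Bool → ℕ → ℕ) (hW : ∀ z, Primrec (W z)) :
    Primrec fun p => W (view eQ p) p := by
  obtain ⟨V, hV, hVv⟩ := primrec_finite_lookup (fun j => W (.inl (eQ.symm j))) fun _ => hW _
  refine (Primrec.ite (Primrec.nat_lt.comp .id (.const q)) (hV.comp .id .id)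
    (Primrec.ite (Primrec.nat_lt.comp (.const q) .id) (hW (.inr true)) (hW (.inr false)))).of_eq
    fun p => ?_
  by_cases h : p < q
  · simpa [view, h] using hVv ⟨p, h⟩ p
  · by_cases h' : q < p <;> simp [view, h, h']

theorem primrec_encode_pafa (ha : 2 ≤ a) : Primrec fun n => (T.pafa eL eC eQ ha n).encode := by
  have hU : Primrec fun n => @encode ((Fin k × Fin (q + 1 + n)) → Bool) _
      (T.pafa eL eC eQ ha n).isUniv :=
    primrec_encode_prod_fun (fun n => (T.pafa eL eC eQ ha n).isUniv)
      (fun c _ => encode (T.ask (eC.symm c)).isNone) (fun _ => .const _) fun _ _ _ => rfl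
  have hδ : Primrec fun n => @encode ((Fin k × Fin (q + 1 + n)) → Option (Fin a) →
      (Fin k × Fin (q + 1 + n)) ⊕ ((Fin a ⊕ Fin 2) → Fin k × Fin (q + 1 + n))) _
      (T.pafa eL eC eQ ha n).δU := by
    refine primrec_encode_prod_fun (fun n => (T.pafa eL eC eQ ha n).δU)
      (fun c p => graphCode ((sortedUniv (Option (Fin a))).map fun σ =>
        transitionCode eL eC eQ p (T.next (eC.symm c) (view eQ p) (σ.map eL.symm))))
      (fun c => ?_) fun n c p => ?_
    · exact primrec_graphCode.comp (primrec_list_map_family (fun (σ : Option (Fin a)) p =>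
        transitionCode eL eC eQ p (T.next (eC.symm c) (view eQ p) (σ.map eL.symm)))
        (fun σ => primrec_of_view eQ
          (fun z p => transitionCode eL eC eQ p (T.next (eC.symm c) z (σ.map eL.symm)))
          fun z => primrec_transitionCode eL eC eQ _) _)
    · refine (encode_fintypeArrow _).trans ?_
      exact congrArg _ (List.map_congr_left fun σ _ => encode_δU T eL eC eQ ha n c p σ)
  have hkp : Primrec fun n => q + 1 + n := Primrec.nat_add.comp (.const _) .id
  have hinit : Primrec fun n => Nat.pair (eC T.start) (q + n) :=
    Primrec₂.natPair.comp (.const _) (Primrec.nat_add.comp (.const _) .id)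
  obtain ⟨e, he⟩ : ∃ e : ℕ, ∀ n, @encode (Fin k → Fin k ⊕ (Fin a → Fin k)) _
      (T.pafa eL eC eQ ha n).δE = e :=
    ⟨@encode (Fin k → Fin k ⊕ (Fin a → Fin k)) _ (T.pafa eL eC eQ ha 0).δE, fun _ => rfl⟩
  refine (Primrec₂.natPair.comp (.const k) (Primrec₂.natPair.comp hkp (Primrec₂.natPair.comp
    (.const a) (Primrec₂.natPair.comp (.const 2) (Primrec₂.natPair.comp hU (Primrec₂.natPair.comp
    (.const e) (Primrec₂.natPair.comp hδ (Primrec₂.natPair.comp hinit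
    (.const (eC T.acc : ℕ)))))))))).of_eq fun n => ?_
  rw [encode_pafa_eq]
  exact congrArg (fun e => Nat.pair k (Nat.pair (q + 1 + n) (Nat.pair a (Nat.pair 2 (Nat.pair _
    (Nat.pair e _)))))) (he n).symm

end CounterTable

end

namespace PAFA

variable {α : Type} (A : PAFA α) {f : A.Strategy} {σ : Option α} {rest : List (Option α)}
  {s : Fin A.kc × Fin A.kp} {h : List (Fin A.g)}

theorem acc_cons_of_inl {s' : Fin A.kc × Fin A.kp} (hu : A.isUniv s = true)
    (hδ : A.δU s σ = .inl s') : A.Acc f (σ :: rest) s h ↔ A.Acc f rest s' h := by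
  rw [Acc, Step, if_pos hu, hδ]

theorem acc_cons_of_inr {fam : Fin A.g ⊕ Fin A.d → Fin A.kc × Fin A.kp} (hu : A.isUniv s = true)
    (hδ : A.δU s σ = .inr fam) : A.Acc f (σ :: rest) s h ↔
      (∀ γ, A.Acc f rest (fam (.inl γ)) (h ++ [γ])) ∧ ∀ δ, A.Acc f rest (fam (.inr δ)) h := by
  rw [Acc, Step, if_pos hu, hδ]

theorem acc_cons_of_existential {fam : Fin A.g → Fin A.kc} (hu : ¬ A.isUniv s = true)
    (hδ : A.δE s.1 = .inr fam) : A.Acc f (σ :: rest) s h ↔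
      A.Acc f rest (fam (f (s.1, h)), s.2) (h ++ [f (s.1, h)]) := by
  rw [Acc, Step, if_neg hu, hδ]

end PAFA

namespace CounterTable

variable {L C Q : Type} (T : CounterTable L C Q)

section

variable {q : ℕ} (eQ : Q ≃ Fin q)

/-- Acceptance of the rest of a tape from a given state by the automata of the family, under a
given existential strategy. -/
def Acc (f : C × List L → L) : List (Option L) → C → ℕ → List L → Prop
  | [], c, _, _ => c = T.acc
  | σ :: rest, c, p, h => match T.ask c with
    | some G => Acc f rest (G (f (c, h))) p (h ++ [f (c, h)])
    | none => match T.next c (view eQ p) σ with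
      | .inl x => Acc f rest x.1 (move eQ p x.2) h
      | .inr (G, x, y) => (∀ γ, Acc f rest (G γ) p (h ++ [γ])) ∧
          Acc f rest x.1 (move eQ p x.2) h ∧ Acc f rest y.1 (move eQ p y.2) h

@[simp]
theorem view_state (j : Q) : view eQ (eQ j) = .inl j := by
  simp [view]

@[simp]
theorem view_counter (m : ℕ) : view eQ (q + m) = .inr (decide (0 < m)) := by
  simp [view]

end

variable {a k q : ℕ} (eL : L ≃ Fin a) (eC : C ≃ Fin k) (eQ : Q ≃ Fin q)

theorem pafa_acc_iff (ha : 2 ≤ a) (n : ℕ) (f : Fin k × List (Fin a) → Fin a)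
    (f' : C × List L → L) (hf : ∀ c h, eL.symm (f (c, h)) = f' (eC.symm c, h.map eL.symm))
    (tape : List (Option (Fin a))) (c : Fin k) (p : Fin (q + 1 + n)) (h : List (Fin a)) :
    (T.pafa eL eC eQ ha n).Acc f tape (c, p) h ↔
      T.Acc eQ f' (tape.map (Option.map eL.symm)) (eC.symm c) p (h.map eL.symm) := by
  induction tape generalizing c p h with
  | nil => exact eC.symm_apply_eq.symm
  | cons σ tape ih =>
    rw [List.map_cons, Acc]
    rcases hask : T.ask (eC.symm c) with _ | G
    · have hu : (T.pafa eL eC eQ ha n).isUniv (c, p) = true := by simp [pafa, hask]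
      rcases hnext : T.next (eC.symm c) (view eQ p) (σ.map eL.symm) with x | ⟨G, x, y⟩
      · have hδ : (T.pafa eL eC eQ ha n).δU (c, p) σ = .inl (state eC eQ n p x) := by
          simp [pafa, hnext]
        refine (PAFA.acc_cons_of_inl _ hu hδ).trans ?_
        refine (ih (eC x.1) (state eC eQ n p x).2 h).trans ?_
        rw [eC.symm_apply_apply]
        rfl
      · have hδ : (T.pafa eL eC eQ ha n).δU (c, p) σ =
            .inr (Sum.elim (fun γ => (eC (G (eL.symm γ)), p))
              fun δ : Fin 2 => if δ = 0 then state eC eQ n p x else state eC eQ n p y) := by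
          simp only [pafa, hnext]
        refine (PAFA.acc_cons_of_inr _ hu hδ).trans (and_congr ?_ ?_)
        · refine Iff.trans (forall_congr' fun γ : Fin a => ?_) eL.symm.forall_congr_right
          refine (ih (eC (G (eL.symm γ))) p (h ++ [γ])).trans ?_
          rw [eC.symm_apply_apply, List.map_append]
          rfl
        · refine Fin.forall_fin_two.trans (and_congr ?_ ?_)
          · refine (ih (eC x.1) (state eC eQ n p x).2 h).trans ?_
            rw [eC.symm_apply_apply]
            rfl
          · refine (ih (eC y.1) (state eC eQ n p y).2 h).trans ?_
            rw [eC.symm_apply_apply]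
            rfl
    · have hu : ¬ (T.pafa eL eC eQ ha n).isUniv (c, p) = true := by simp [pafa, hask]
      have hδ : (T.pafa eL eC eQ ha n).δE c = .inr fun γ => eC (G (eL.symm γ)) := by
        simp [pafa, hask]
      refine (PAFA.acc_cons_of_existential _ hu hδ).trans ?_
      refine (ih (eC (G (eL.symm (f (c, h))))) p (h ++ [f (c, h)])).trans ?_
      rw [eC.symm_apply_apply, List.map_append, List.map_singleton, hf]

theorem mem_lang_pafa (ha : 2 ≤ a) (n : ℕ) (w : List (Fin a)) :
    w ∈ (T.pafa eL eC eQ ha n).lang ↔ ∃ f : C × List L → L,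
      T.Acc eQ f (PAFA.tape (w.map eL.symm)) T.start (q + n) [] := by
  have htape : (PAFA.tape w).map (Option.map eL.symm) = PAFA.tape (w.map eL.symm) := by
    simp [PAFA.tape, List.map_flatMap, List.flatMap_map]
  have h := fun (f : Fin k × List (Fin a) → Fin a) f' hf =>
    T.pafa_acc_iff eL eC eQ ha n f f' hf (PAFA.tape w) (eC T.start)
    ⟨q + n, by omega⟩ []
  simp only [htape, eC.symm_apply_apply, List.map_nil] at h
  constructor
  · rintro ⟨f : Fin k × List (Fin a) → Fin a, hf⟩
    exact ⟨fun x => eL.symm (f (eC x.1, x.2.map eL)), (h f _ (by simp)).1 hf⟩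
  · rintro ⟨f, hf⟩
    exact ⟨fun x => eL (f (eC.symm x.1, x.2.map eL.symm)), (h _ f (by simp)).2 hf⟩

end CounterTable

/-- Data for a game in which a word is read by a one-counter automaton, or is compared with a word
announced by the existential player, either from its beginning or from its first separator. -/
structure Checker (L S Q : Type) where
  /-- the separator letters -/
  sep : L → Bool
  /-- the transitions of the one-counter automaton; the flag tells whether to decrement -/
  count : S → Bool → L → Option (S × Bool)
  count_start : S
  count_acc : S → Bool
  /-- the transitions reading an announced letter and a letter of the word -/
  compare : Q → L → L → Option Q
  compare_acc : Q → Bool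
  /-- the initial state for the comparison with the whole word -/
  whole : Q
  /-- the initial state for the comparison with the word after the first separator -/
  suffix : Q

namespace Checker

variable {L S Q : Type} (K : Checker L S Q)

/-- The common components. -/
inductive Common (L S : Type)
  | start
  | acc
  | rej
  | ask
  | askNext
  | got (l : L)
  | wait
  | waitNext
  | count (s : S)
  | countNext (s : S)

instance [Finite L] [Finite S] : Finite (Common L S) := by
  let F : Fin 7 ⊕ L ⊕ S ⊕ S → Common L S := Sum.elim
    ![.start, .acc, .rej, .ask, .askNext, .wait, .waitNext]
    (Sum.elim .got (Sum.elim .count .countNext))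
  refine Finite.of_surjective F fun c => ?_
  cases c with
  | start => exact ⟨.inl 0, rfl⟩
  | acc => exact ⟨.inl 1, rfl⟩
  | rej => exact ⟨.inl 2, rfl⟩
  | ask => exact ⟨.inl 3, rfl⟩
  | askNext => exact ⟨.inl 4, rfl⟩
  | wait => exact ⟨.inl 5, rfl⟩
  | waitNext => exact ⟨.inl 6, rfl⟩
  | got l => exact ⟨.inr (.inl l), rfl⟩
  | count s => exact ⟨.inr (.inr (.inl s)), rfl⟩
  | countNext s => exact ⟨.inr (.inr (.inr s)), rfl⟩

/-- Whether a word is accepted by the one-counter automaton. -/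
def RunCount : S → ℕ → List L → Prop
  | s, _, [] => K.count_acc s = true
  | s, m, l :: w => ∃ t, K.count s (decide (0 < m)) l = some t ∧
      RunCount t.1 (if t.2 then m - 1 else m) w

/-- Whether the comparison of an announced word with a word succeeds. -/
def RunCompare : Q → List L → List L → Prop
  | p, _, [] => K.compare_acc p = true
  | _, [], _ :: _ => False
  | p, l' :: w', l :: w => ∃ p', K.compare p l' l = some p' ∧ RunCompare p' w' w

/-- The part of a word after the first separator. -/
def afterSep : List L → List L
  | [] => []
  | l :: w => if K.sep l then w else afterSep w

/-- The word announced by a strategy, up to a given length. -/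
def announced (g : List L → L) : ℕ → List L → List L
  | 0, _ => []
  | m + 1, h => g h :: announced g m (h ++ [g h])

/-- The first half of the transitions of the game on an input letter, and the second half. -/
def table : CounterTable L (Common L S) Q where
  ask
    | .ask => some .got
    | _ => none
  next c z σ := match c, z, σ with
    | .start, _, _ => .inr (fun _ => .countNext K.count_start, (.askNext, .to K.whole),
        (.waitNext, .to K.suffix))
    | .acc, _, _ => .inl (.acc, .keep)
    | .rej, _, _ => .inl (.rej, .keep)
    | .ask, _, _ => .inl (.rej, .keep)
    | .askNext, _, _ => .inl (.ask, .keep)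
    | .got _, .inr _, _ => .inl (.rej, .keep)
    | .got _, .inl p, none => .inl (if K.compare_acc p then .acc else .rej, .keep)
    | .got l', .inl p, some l => match K.compare p l' l with
      | some p' => .inl (.ask, .to p')
      | none => .inl (.rej, .keep)
    | .wait, _, none => .inl (.acc, .keep)
    | .wait, _, some l => .inl (if K.sep l then .askNext else .waitNext, .keep)
    | .waitNext, _, _ => .inl (.wait, .keep)
    | .count _, .inl _, _ => .inl (.rej, .keep)
    | .count s, .inr _, none => .inl (if K.count_acc s then .acc else .rej, .keep)
    | .count s, .inr b, some l => match K.count s b l with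
      | some t => .inl (.countNext t.1, if t.2 && b then .dec else .keep)
      | none => .inl (.rej, .keep)
    | .countNext s, _, _ => .inl (.count s, .keep)
  start := .start
  acc := .acc

variable {q : ℕ} (eQ : Q ≃ Fin q) (f : Common L S × List L → L)

/-- The rest of the tape after the beginning of a letter. -/
def doubled (w : List L) : List (Option L) :=
  (w.map some ++ [none]).flatMap fun σ => [σ, σ]

theorem doubled_nil : doubled ([] : List L) = [none, none] := rfl

theorem doubled_cons (l : L) (w : List L) : doubled (l :: w) = some l :: some l :: doubled w := rfl

theorem not_acc_rej (tape : List (Option L)) (p : ℕ) (h : List L) :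
    ¬ K.table.Acc eQ f tape .rej p h := by
  induction tape with
  | nil => simp [CounterTable.Acc, table]
  | cons σ tape ih => simpa [CounterTable.Acc, table, CounterTable.move] using ih

theorem acc_count (w : List L) (s : S) (m : ℕ) (h : List L) :
    K.table.Acc eQ f (doubled w) (.count s) (q + m) h ↔ K.RunCount s m w := by
  induction w generalizing s m with
  | nil =>
    rw [doubled_nil, RunCount]
    cases hs : K.count_acc s <;> simp [CounterTable.Acc, table, CounterTable.move, hs]
  | cons l w ih =>
    rw [doubled_cons, RunCount]
    rcases hs : K.count s (decide (0 < m)) l with _ | ⟨s', b⟩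
    · simpa [CounterTable.Acc, table, CounterTable.move, hs] using not_acc_rej K eQ f _ _ _
    · cases b
      · simpa [CounterTable.Acc, table, CounterTable.move, hs] using ih s' m
      · rcases m with _ | m
        · have hv : CounterTable.view eQ q = .inr false := CounterTable.view_counter eQ 0
          simp only [lt_irrefl, decide_false] at hs
          simpa [CounterTable.Acc, table, CounterTable.move, hs, hv] using ih s' 0
        · have hq : q + (m + 1) - 1 = q + m := rfl
          simp only [Nat.succ_pos, decide_true] at hs
          simpa [CounterTable.Acc, table, CounterTable.move, hs, hq] using ih s' m

theorem acc_ask (w : List L) (p : Q) (h : List L) (m : ℕ) (hm : w.length ≤ m) :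
    K.table.Acc eQ f (doubled w) .ask (eQ p) h ↔
      K.RunCompare p (announced (fun h => f (.ask, h)) m h) w := by
  induction w generalizing p h m with
  | nil =>
    rw [doubled_nil, RunCompare]
    cases hs : K.compare_acc p <;> simp [CounterTable.Acc, table, hs]
  | cons l w ih =>
    obtain ⟨m, rfl⟩ : ∃ m', m = m' + 1 := ⟨m - 1, by simp at hm; omega⟩
    rw [doubled_cons, announced, RunCompare]
    rcases hs : K.compare p (f (.ask, h)) l with _ | p'
    · simpa [CounterTable.Acc, table, CounterTable.move, hs] using not_acc_rej K eQ f _ _ _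
    · simpa [CounterTable.Acc, table, CounterTable.move, hs] using
        ih p' (h ++ [f (.ask, h)]) m (by simpa using hm)

theorem acc_wait (w : List L) (p : Q) (hp : K.compare_acc p = true) (m : ℕ) (hm : w.length ≤ m) :
    K.table.Acc eQ f (doubled w) .wait (eQ p) [] ↔
      K.RunCompare p (announced (fun h => f (.ask, h)) m []) (K.afterSep w) := by
  induction w with
  | nil => simp [doubled_nil, afterSep, RunCompare, CounterTable.Acc, table, hp]
  | cons l w ih =>
    have hm' : w.length ≤ m := (Nat.le_succ _).trans hm
    rw [doubled_cons, afterSep]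
    cases hs : K.sep l
    · simpa [CounterTable.Acc, table, CounterTable.move, hs] using ih hm'
    · simpa [CounterTable.Acc, table, CounterTable.move, hs] using acc_ask K eQ f w p [] m hm'

theorem length_announced (g : List L → L) (m : ℕ) (h : List L) :
    (announced g m h).length = m := by
  induction m generalizing h with
  | zero => rfl
  | succ m ih => simp [announced, ih]

theorem announced_getD (w : List L) (x : L) (h w' : List L) (hw : w = h ++ w') :
    announced (fun h => w.getD h.length x) w'.length h = w' := by
  induction w' generalizing h with
  | nil => rfl
  | cons l w' ih =>
    have hl : w.getD h.length x = l := by simp [hw]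
    rw [List.length_cons, announced, hl, ih _ (by simp [hw])]

theorem exists_strategy_iff [Inhabited L] (hsuffix : K.compare_acc K.suffix = true)
    (hwhole : ∀ w' w : List L, w'.length = w.length → K.RunCompare K.whole w' w → w' = w)
    (n : ℕ) (w : List L) :
    (∃ f : Common L S × List L → L,
        K.table.Acc eQ f (PAFA.tape w) K.table.start (q + n) []) ↔
      K.RunCount K.count_start n w ∧ K.RunCompare K.whole w w ∧
        K.RunCompare K.suffix w (K.afterSep w) := by
  have htape : PAFA.tape w = none :: none :: doubled w := rfl
  have key : ∀ f : Common L S × List L → L,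
      K.table.Acc eQ f (PAFA.tape w) K.table.start (q + n) [] ↔
        K.RunCount K.count_start n w ∧
        K.RunCompare K.whole (announced (fun h => f (.ask, h)) w.length []) w ∧
        K.RunCompare K.suffix (announced (fun h => f (.ask, h)) w.length []) (K.afterSep w) := by
    intro f
    rw [← acc_wait K eQ f w K.suffix hsuffix _ le_rfl, ← acc_ask K eQ f w _ [] _ le_rfl, htape]
    have hcount := fun h => acc_count K eQ f w K.count_start n h
    simp [CounterTable.Acc, table, CounterTable.move] at hcount ⊢
    simp [hcount]
  constructor
  · rintro ⟨f, hf⟩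
    obtain ⟨h₁, h₂, h₃⟩ := (key f).1 hf
    have hw := hwhole _ _ (length_announced _ _ _) h₂
    rw [hw] at h₂ h₃
    exact ⟨h₁, h₂, h₃⟩
  · rintro ⟨h₁, h₂, h₃⟩
    refine ⟨fun x => w.getD x.2.length default, (key _).2 ?_⟩
    have hw := announced_getD w default [] w rfl
    simp only [hw]
    exact ⟨h₁, h₂, h₃⟩

end Checker

namespace TuringRows

open Turing

/-- A letter is either a separator or a tape cell, marked by a state if the head is there. -/
abbrev Letter (Γ Λ : Type) := Option (Γ × Option Λ)

/-- The states of the automaton recognising the shape of the initial row. -/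
inductive RowState
  | before
  | second
  | counting
  | after
  | rest

instance : Finite RowState :=
  Finite.of_surjective ![RowState.before, .second, .counting, .after, .rest] fun s => by
    cases s with
    | before => exact ⟨0, rfl⟩
    | second => exact ⟨1, rfl⟩
    | counting => exact ⟨2, rfl⟩
    | after => exact ⟨3, rfl⟩
    | rest => exact ⟨4, rfl⟩

/-- The states for the comparison of words: `seek`, `found`, `done` are used to look for a halting
cell followed by a separator, and `idle`, `carry`, `expect` to check successive rows. -/
inductive CompareState (Λ : Type)
  | seek
  | found
  | done
  | idle
  | carry (q : Λ)
  | expect (q : Λ)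

instance (Λ : Type) [Finite Λ] : Finite (CompareState Λ) := by
  let F : Fin 4 ⊕ Λ ⊕ Λ → CompareState Λ :=
    Sum.elim ![.seek, .found, .done, .idle] (Sum.elim .carry .expect)
  refine Finite.of_surjective F fun s => ?_
  cases s with
  | seek => exact ⟨.inl 0, rfl⟩
  | found => exact ⟨.inl 1, rfl⟩
  | done => exact ⟨.inl 2, rfl⟩
  | idle => exact ⟨.inl 3, rfl⟩
  | carry q => exact ⟨.inr (.inl q), rfl⟩
  | expect q => exact ⟨.inr (.inr q), rfl⟩

variable {Γ Λ : Type} [Inhabited Γ] [Inhabited Λ]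

open Classical in
/-- The checker for the histories of a machine, with initial tape contents `x`, `y`, and as many
`z` as the initial value of the counter. -/
noncomputable def checker (M : TM0.Machine Γ Λ) (x y z : Γ) :
    Checker (Letter Γ Λ) RowState (CompareState Λ) where
  sep := Option.isNone
  count
    | .before, _, some c => if c = (default, none) then some (.before, false) else
        if c = (x, some default) then some (.second, false) else none
    | .second, _, some c => if c = (y, none) then some (.counting, false) else none
    | .counting, true, some c => if c = (z, none) then some (.counting, true) else none
    | .counting, false, some c => if c = (default, none) then some (.after, false) else none
    | .counting, false, none => some (.rest, false)
    | .after, _, some c => if c = (default, none) then some (.after, false) else none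
    | .after, _, none => some (.rest, false)
    | .rest, _, _ => some (.rest, false)
    | _, _, _ => none
  count_start := .before
  count_acc
    | .rest => true
    | _ => false
  compare
    | .seek, l', l => if l' = l then
        match l with
        | some (a, some q) => if M q a = none then some .found else some .seek
        | _ => some .seek
      else none
    | .found, l', l => if l' = l then some (if l = none then .done else .found) else none
    | .done, l', l => if l' = l then some .done else none
    | .idle, none, none => some .idle
    | .idle, some (b, none), some (b', o) => if b = b' then
        match o with
        | none => some .idle
        | some q => some (.expect q)
      else none
    | .idle, some (a, some q), some c => match M q a with
      | some (q', .write e) => if c = (e, some q') then some .idle else none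
      | some (q', .move .right) => if c = (a, none) then some (.carry q') else none
      | _ => none
    | .carry q, some (b, none), some c => if c = (b, some q) then some .idle else none
    | .expect q', some (a, some q), some c =>
      if M q a = some (q', .move .left) ∧ c = (a, none) then some .idle else none
    | _, _, _ => none
  compare_acc
    | .seek => false
    | .found => false
    | _ => true
  whole := .seek
  suffix := .idle

/-- A finite description of a configuration: the cells to the left of the head, starting from the
head, the state, the cell under the head, and the cells to its right. -/
structure Row (Γ Λ : Type) where
  left : List Γ
  state : Λ
  head : Γ
  right : List Γ

/-- The cells of a part of a row without the head. -/
def plain (Λ : Type) (l : List Γ) : List (Letter Γ Λ) := l.map fun a => some (a, none)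

/-- A row as a word. -/
def Row.word (ρ : Row Γ Λ) : List (Letter Γ Λ) :=
  plain Λ ρ.left.reverse ++ some (ρ.head, some ρ.state) :: plain Λ ρ.right

/-- The configuration described by a row. -/
def Row.cfg (ρ : Row Γ Λ) : TM0.Cfg Γ Λ :=
  ⟨ρ.state, Tape.mk' (ListBlank.mk ρ.left) (ListBlank.mk (ρ.head :: ρ.right))⟩

/-- The steps of a machine on rows. -/
inductive Row.Step (M : TM0.Machine Γ Λ) : Row Γ Λ → Row Γ Λ → Prop
  | write {l q a r q' e} (h : M q a = some (q', .write e)) : Step M ⟨l, q, a, r⟩ ⟨l, q', e, r⟩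
  | right {l q a r q' b} (h : M q a = some (q', .move .right)) :
      Step M ⟨l, q, a, b :: r⟩ ⟨a :: l, q', b, r⟩
  | left {l q a r q' b} (h : M q a = some (q', .move .left)) :
      Step M ⟨b :: l, q, a, r⟩ ⟨l, q', b, a :: r⟩

theorem Row.Step.step_cfg {M : TM0.Machine Γ Λ} {ρ ρ' : Row Γ Λ} (h : ρ.Step M ρ') :
    TM0.step M ρ.cfg = some ρ'.cfg := by
  cases h with
  | write h =>
    simp [Row.cfg, TM0.step, h, Tape.mk'_head]
  | right h =>
    simp [Row.cfg, TM0.step, h]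
  | left h =>
    simp [Row.cfg, TM0.step, h]

theorem Row.step_cfg_eq_none {M : TM0.Machine Γ Λ} {ρ : Row Γ Λ} :
    TM0.step M ρ.cfg = none ↔ M ρ.state ρ.head = none := by
  simp [Row.cfg, TM0.step]

omit [Inhabited Γ] in
theorem Row.exists_step {M : TM0.Machine Γ Λ} {ρ : Row Γ Λ} {n : ℕ}
    (h : M ρ.state ρ.head ≠ none) (hl : n + 1 ≤ ρ.left.length) (hr : n + 1 ≤ ρ.right.length) :
    ∃ ρ', ρ.Step M ρ' ∧ n ≤ ρ'.left.length ∧ n ≤ ρ'.right.length := by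
  obtain ⟨l, q, a, r⟩ := ρ
  simp only at h hl hr
  obtain ⟨⟨q', s⟩, hM⟩ := Option.ne_none_iff_exists'.1 h
  rcases s with (_ | _) | e
  · rcases l with _ | ⟨b, l⟩
    · simp at hl
    · exact ⟨_, .left hM, by simpa using hl, by simp; omega⟩
  · rcases r with _ | ⟨b, r⟩
    · simp at hr
    · exact ⟨_, .right hM, by simp; omega, by simpa using hr⟩
  · exact ⟨_, .write hM, by simp; omega, by simp; omega⟩

variable {M : TM0.Machine Γ Λ} {x y z : Γ}

theorem eq_of_runCompare_seek {p : CompareState Λ} (hp : p = .seek ∨ p = .found ∨ p = .done)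
    {w' w : List (Letter Γ Λ)} (hw : w'.length = w.length)
    (h : (checker M x y z).RunCompare p w' w) : w' = w := by
  induction w generalizing p w' with
  | nil => simpa using hw
  | cons l w ih =>
    obtain _ | ⟨l', w'⟩ := w'
    · simp at hw
    · obtain ⟨p', hp', h⟩ := h
      have key : l' = l ∧ (p' = .seek ∨ p' = .found ∨ p' = .done) := by
        rcases hp with rfl | rfl | rfl
        · simp only [checker] at hp'
          split_ifs at hp' with hl
          refine ⟨hl, ?_⟩
          split at hp'
          · split_ifs at hp' <;> simp_all
          · simp_all
        · simp only [checker] at hp'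
          split_ifs at hp' <;> simp_all
        · simp only [checker] at hp'
          split_ifs at hp'
          simp_all
      rw [key.1, ih key.2 (by simpa using hw) h]

theorem runCompare_done (w : List (Letter Γ Λ)) : (checker M x y z).RunCompare .done w w := by
  induction w with
  | nil => rfl
  | cons l w ih => exact ⟨.done, by simp [checker], ih⟩

theorem runCompare_found_plain (l : List Γ) (w : List (Letter Γ Λ)) :
    (checker M x y z).RunCompare .found (plain Λ l ++ none :: w) (plain Λ l ++ none :: w) := by
  induction l with
  | nil => exact ⟨.done, by simp [checker], runCompare_done w⟩
  | cons b l ih => exact ⟨.found, by simp [checker], ih⟩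

theorem runCompare_seek_plain (l : List Γ) (w : List (Letter Γ Λ)) :
    (checker M x y z).RunCompare .seek (plain Λ l ++ w) (plain Λ l ++ w) ↔
      (checker M x y z).RunCompare .seek w w := by
  induction l with
  | nil => rfl
  | cons b l ih => simpa [plain, Checker.RunCompare, checker] using ih

theorem runCompare_seek_word (ρ : Row Γ Λ) (v : List (Letter Γ Λ)) :
    (checker M x y z).RunCompare .seek (ρ.word ++ none :: v) (ρ.word ++ none :: v) ↔
      M ρ.state ρ.head = none ∨ (checker M x y z).RunCompare .seek v v := by
  rw [Row.word, List.append_assoc, runCompare_seek_plain, List.cons_append]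
  by_cases hM : M ρ.state ρ.head = none
  · refine iff_of_true ⟨.found, by simp [checker, hM], runCompare_found_plain _ _⟩ (.inl hM)
  · have h : (checker M x y z).compare .seek (some (ρ.head, some ρ.state))
        (some (ρ.head, some ρ.state)) = some .seek := by simp [checker, hM]
    have h' : (checker M x y z).compare .seek none none = some .seek := by simp [checker]
    simp [Checker.RunCompare, h, hM, runCompare_seek_plain, h']

theorem exists_separator_of_runCompare {p : CompareState Λ} (hp : p = .seek ∨ p = .found)
    {v : List (Letter Γ Λ)} (h : (checker M x y z).RunCompare p v v) :
    ∃ (u : List (Γ × Option Λ)) (v' : List (Letter Γ Λ)), v = u.map some ++ none :: v' := by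
  induction v generalizing p with
  | nil => rcases hp with rfl | rfl <;> simp [Checker.RunCompare, checker] at h
  | cons l v ih =>
    rcases l with _ | c
    · exact ⟨[], v, rfl⟩
    · obtain ⟨p', hp', h⟩ := h
      have hp'' : p' = .seek ∨ p' = .found := by
        rcases hp with rfl | rfl
        · simp only [checker, if_true] at hp'
          split at hp'
          · split_ifs at hp' <;> simp_all
          · simp_all
        · simp_all [checker]
      obtain ⟨u, v', rfl⟩ := ih hp'' h
      exact ⟨c :: u, v', rfl⟩

theorem runCompare_idle_append (l : List Γ) (w v : List (Letter Γ Λ)) :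
    (checker M x y z).RunCompare .idle (plain Λ l ++ w) (plain Λ l ++ v) ↔
      (checker M x y z).RunCompare .idle w v := by
  induction l with
  | nil => rfl
  | cons b l ih => simpa [plain, Checker.RunCompare, checker] using ih

theorem runCompare_idle_of_step {ρ ρ' : Row Γ Λ} (h : ρ.Step M ρ') {w v : List (Letter Γ Λ)}
    (hw : (checker M x y z).RunCompare .idle w v) :
    (checker M x y z).RunCompare .idle (ρ.word ++ none :: w) (ρ'.word ++ none :: v) := by
  have hsep : ∀ l, (checker M x y z).RunCompare .idle (plain Λ l ++ none :: w)
      (plain Λ l ++ none :: v) := fun l =>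
    (runCompare_idle_append l _ _).2 ⟨.idle, by simp [checker], hw⟩
  cases h with
  | @write l q a r q' e h =>
    simp only [Row.word, List.append_assoc, runCompare_idle_append, List.cons_append]
    exact ⟨.idle, by simp [checker, h], hsep r⟩
  | @right l q a r q' b h =>
    simp only [Row.word, List.append_assoc, List.cons_append, List.reverse_cons, plain,
      List.map_append, List.map_cons, List.map_nil, List.nil_append]
    refine (runCompare_idle_append l.reverse _ _).2 ⟨.carry q', by simp [checker, h], .idle, ?_, hsep r⟩
    simp [checker]
  | @left l q a r q' b h =>
    simp only [Row.word, List.append_assoc, List.cons_append, List.reverse_cons, plain,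
      List.map_append, List.map_cons, List.map_nil, List.nil_append]
    refine (runCompare_idle_append l.reverse _ _).2 ⟨.expect q', by simp [checker], .idle, ?_, hsep r⟩
    simp [checker, h]

theorem eq_of_runCompare_idle_plain {r : List Γ} {u : List (Γ × Option Λ)}
    {w v : List (Letter Γ Λ)} (h : (checker M x y z).RunCompare .idle (plain Λ r ++ none :: w)
      (u.map some ++ none :: v)) :
    u.map some = plain Λ r ∧ (checker M x y z).RunCompare .idle w v := by
  induction r generalizing u with
  | nil =>
    rcases u with _ | ⟨c, u⟩
    · simpa [plain, Checker.RunCompare, checker] using h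
    · simp [plain, Checker.RunCompare, checker] at h
  | cons b r ih =>
    rcases u with _ | ⟨⟨b', _ | q⟩, u⟩
    · simp [plain, Checker.RunCompare, checker] at h
    · obtain ⟨p', hp', h⟩ := h
      simp only [checker, Option.ite_none_right_eq_some, Option.some.injEq] at hp'
      obtain ⟨rfl, rfl⟩ := hp'
      obtain ⟨h₁, h₂⟩ := ih h
      exact ⟨by simp [h₁, plain], h₂⟩
    · obtain ⟨p', hp', h⟩ := h
      simp only [checker, Option.ite_none_right_eq_some, Option.some.injEq] at hp'
      obtain ⟨rfl, rfl⟩ := hp'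
      obtain _ | ⟨b', r⟩ := r <;> obtain _ | ⟨c, u⟩ := u <;>
        simp [Checker.RunCompare, checker] at h

theorem eq_of_runCompare_carry {q : Λ} {r : List Γ} {u : List (Γ × Option Λ)}
    {w v : List (Letter Γ Λ)} (h : (checker M x y z).RunCompare (.carry q)
      (plain Λ r ++ none :: w) (u.map some ++ none :: v)) :
    ∃ b r', r = b :: r' ∧ u.map some = some (b, some q) :: plain Λ r' ∧
      (checker M x y z).RunCompare .idle w v := by
  obtain _ | ⟨b, r⟩ := r <;> obtain _ | ⟨c, u⟩ := u
  · simp [plain, Checker.RunCompare, checker] at h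
  · simp [plain, Checker.RunCompare, checker] at h
  · simp [plain, Checker.RunCompare, checker] at h
  · obtain ⟨p', hp', h⟩ := h
    simp only [checker, Option.ite_none_right_eq_some, Option.some.injEq] at hp'
    obtain ⟨rfl, rfl⟩ := hp'
    obtain ⟨h₁, h₂⟩ := eq_of_runCompare_idle_plain h
    exact ⟨b, r, rfl, by simp [h₁], h₂⟩

omit [Inhabited Γ] in
theorem Row.Step.append {l l' r r' : List Γ} {q q' : Λ} {a a' : Γ}
    (h : Row.Step M ⟨l, q, a, r⟩ ⟨l', q', a', r'⟩) (b : Γ) :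
    Row.Step M ⟨l ++ [b], q, a, r⟩ ⟨l' ++ [b], q', a', r'⟩ := by
  cases h with
  | write h => exact .write h
  | right h => exact .right h
  | left h => exact .left h

theorem exists_step_of_runCompare_idle {l : List Γ} {q : Λ} {a : Γ} {r : List Γ}
    {u : List (Γ × Option Λ)} {w v : List (Letter Γ Λ)}
    (h : (checker M x y z).RunCompare .idle
      (plain Λ l ++ some (a, some q) :: plain Λ r ++ none :: w) (u.map some ++ none :: v)) :
    ∃ ρ', Row.Step M ⟨l.reverse, q, a, r⟩ ρ' ∧ u.map some = ρ'.word ∧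
      (checker M x y z).RunCompare .idle w v := by
  induction l generalizing u with
  | nil =>
    rcases u with _ | ⟨c, u⟩
    · simp [plain, Checker.RunCompare, checker] at h
    · obtain ⟨p', hp', h⟩ := h
      simp only [checker] at hp'
      split at hp'
      · rename_i q' e hM
        simp only [Option.ite_none_right_eq_some, Option.some.injEq] at hp'
        obtain ⟨rfl, rfl⟩ := hp'
        obtain ⟨h₁, h₂⟩ := eq_of_runCompare_idle_plain h
        exact ⟨_, .write hM, by simp [h₁, Row.word, plain], h₂⟩
      · rename_i q' hM
        simp only [Option.ite_none_right_eq_some, Option.some.injEq] at hp'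
        obtain ⟨rfl, rfl⟩ := hp'
        obtain ⟨b, r, rfl, h₁, h₂⟩ := eq_of_runCompare_carry h
        exact ⟨_, .right hM, by simp [h₁, Row.word, plain], h₂⟩
      · simp at hp'
  | cons b l ih =>
    rcases u with _ | ⟨⟨b', _ | q'⟩, u⟩
    · simp [plain, Checker.RunCompare, checker] at h
    · obtain ⟨p', hp', h⟩ := h
      simp only [checker, Option.ite_none_right_eq_some, Option.some.injEq] at hp'
      obtain ⟨rfl, rfl⟩ := hp'
      obtain ⟨⟨l', q', a', r'⟩, h₁, h₂, h₃⟩ := ih h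
      refine ⟨⟨l' ++ [b], q', a', r'⟩, ?_, by simp [h₂, Row.word, plain], h₃⟩
      rw [List.reverse_cons]
      exact h₁.append b
    · obtain ⟨p', hp', h⟩ := h
      simp only [checker, Option.ite_none_right_eq_some, Option.some.injEq] at hp'
      obtain ⟨rfl, rfl⟩ := hp'
      obtain _ | ⟨b', l⟩ := l <;> obtain _ | ⟨c, u⟩ := u
      · simp [plain, Checker.RunCompare, checker] at h
      · obtain ⟨p', hp', h⟩ := h
        simp only [checker, Option.ite_none_right_eq_some, Option.some.injEq] at hp'
        obtain ⟨⟨hM, rfl⟩, rfl⟩ := hp'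
        obtain ⟨h₁, h₂⟩ := eq_of_runCompare_idle_plain h
        exact ⟨_, .left hM, by simp [h₁, Row.word, plain], h₂⟩
      · simp [plain, Checker.RunCompare, checker] at h
      · simp [plain, Checker.RunCompare, checker] at h

theorem dom_eval_of_runCompare (ρ : Row Γ Λ) (v : List (Letter Γ Λ))
    (hidle : (checker M x y z).RunCompare .idle (ρ.word ++ none :: v) v)
    (hseek : (checker M x y z).RunCompare .seek (ρ.word ++ none :: v) (ρ.word ++ none :: v)) :
    (StateTransition.eval (TM0.step M) ρ.cfg).Dom := by
  by_cases hM : M ρ.state ρ.head = none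
  · exact Part.dom_iff_mem.2 ⟨_, StateTransition.mem_eval.2
      ⟨.refl, Row.step_cfg_eq_none.2 hM⟩⟩
  · have hv := ((runCompare_seek_word ρ v).1 hseek).resolve_left hM
    obtain ⟨u, v', rfl⟩ := exists_separator_of_runCompare (.inl rfl) hv
    have hstep := exists_step_of_runCompare_idle (l := ρ.left.reverse) (q := ρ.state)
      (a := ρ.head) (r := ρ.right) hidle
    rw [List.reverse_reverse] at hstep
    obtain ⟨ρ', h₁, h₂, h₃⟩ := hstep
    rw [h₂] at h₃ hv
    rw [StateTransition.reaches_eval (b := ρ'.cfg) (.single h₁.step_cfg)]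
    exact dom_eval_of_runCompare ρ' v' h₃ hv
termination_by v.length
decreasing_by subst_vars; simp; omega

theorem exists_runCompare {c d : TM0.Cfg Γ Λ} (h : StateTransition.Reaches (TM0.step M) c d)
    (hd : TM0.step M d = none) :
    ∃ t, ∀ ρ : Row Γ Λ, ρ.cfg = c → t ≤ ρ.left.length → t ≤ ρ.right.length →
      ∃ v, (checker M x y z).RunCompare .idle (ρ.word ++ none :: v) v ∧
        (checker M x y z).RunCompare .seek (ρ.word ++ none :: v) (ρ.word ++ none :: v) := by
  induction h using Relation.ReflTransGen.head_induction_on with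
  | refl =>
    refine ⟨0, fun ρ hρ _ _ => ⟨[], by simp [Checker.RunCompare, checker], ?_⟩⟩
    exact (runCompare_seek_word ρ _).2 (.inl (Row.step_cfg_eq_none.1 (hρ ▸ hd)))
  | @head c c' hc _ ih =>
    obtain ⟨t, ht⟩ := ih
    refine ⟨t + 1, fun ρ hρ hl hr => ?_⟩
    subst hρ
    have hM : M ρ.state ρ.head ≠ none := fun hM => by
      simp [Row.step_cfg_eq_none.2 hM] at hc
    obtain ⟨ρ', hs, hl', hr'⟩ := Row.exists_step hM hl hr
    have hc' : ρ'.cfg = c' := by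
      have := hs.step_cfg
      rw [Option.mem_def] at hc
      simpa [hc] using this.symm
    obtain ⟨v, h₁, h₂⟩ := ht ρ' hc' hl' hr'
    exact ⟨ρ'.word ++ none :: v, runCompare_idle_of_step hs h₁,
      (runCompare_seek_word ρ _).2 (.inr h₂)⟩

theorem runCount_rest (n : ℕ) (w : List (Letter Γ Λ)) : (checker M x y z).RunCount .rest n w := by
  induction w with
  | nil => rfl
  | cons l w ih => exact ⟨(.rest, false), by simp [checker], ih⟩

theorem runCount_after {n : ℕ} {w : List (Letter Γ Λ)} :
    (checker M x y z).RunCount .after n w ↔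
      ∃ j v, w = plain Λ (List.replicate j default) ++ none :: v := by
  constructor
  · intro h
    induction w with
    | nil => simp [Checker.RunCount, checker] at h
    | cons l w ih =>
      obtain ⟨t, ht, h⟩ := h
      rcases l with _ | c
      · exact ⟨0, w, rfl⟩
      · simp only [checker, Option.ite_none_right_eq_some, Option.some.injEq] at ht
        obtain ⟨rfl, rfl⟩ := ht
        obtain ⟨j, v, rfl⟩ := ih h
        exact ⟨j + 1, v, rfl⟩
  · rintro ⟨j, v, rfl⟩
    induction j with
    | zero => exact ⟨(.rest, false), by simp [checker], runCount_rest _ _⟩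
    | succ j ih => exact ⟨(.after, false), by simp [checker], ih⟩

theorem runCount_counting {n : ℕ} {w : List (Letter Γ Λ)} :
    (checker M x y z).RunCount .counting n w ↔
      ∃ j v, w = plain Λ (List.replicate n z ++ List.replicate j default) ++ none :: v := by
  induction n generalizing w with
  | zero =>
    constructor
    · intro h
      obtain _ | ⟨_ | c, w⟩ := w
      · simp [Checker.RunCount, checker] at h
      · exact ⟨0, w, rfl⟩
      · obtain ⟨t, ht, h⟩ := h
        simp only [lt_irrefl, decide_false, checker, Option.ite_none_right_eq_some,
          Option.some.injEq] at ht
        obtain ⟨rfl, rfl⟩ := ht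
        obtain ⟨j, v, rfl⟩ := runCount_after.1 h
        exact ⟨j + 1, v, rfl⟩
    · rintro ⟨_ | j, v, rfl⟩
      · exact ⟨(.rest, false), by simp [checker], runCount_rest _ _⟩
      · exact ⟨(.after, false), by simp [checker], runCount_after.2 ⟨j, v, rfl⟩⟩
  | succ n ih =>
    constructor
    · intro h
      obtain _ | ⟨_ | c, w⟩ := w
      · simp [Checker.RunCount, checker] at h
      · simp [Checker.RunCount, checker] at h
      · obtain ⟨t, ht, h⟩ := h
        simp only [Nat.succ_pos, decide_true, checker, Option.ite_none_right_eq_some,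
          Option.some.injEq] at ht
        obtain ⟨rfl, rfl⟩ := ht
        obtain ⟨j, v, rfl⟩ := ih.1 h
        exact ⟨j, v, rfl⟩
    · rintro ⟨j, v, rfl⟩
      exact ⟨(.counting, true), by simp [checker], ih.2 ⟨j, v, rfl⟩⟩

/-- The rows for the initial configuration. -/
def initialRow (Λ : Type) [Inhabited Λ] (x y z : Γ) (n i j : ℕ) : Row Γ Λ :=
  ⟨List.replicate i default, default, x, y :: (List.replicate n z ++ List.replicate j default)⟩

theorem runCount_before {n : ℕ} {w : List (Letter Γ Λ)} :
    (checker M x y z).RunCount .before n w ↔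
      ∃ i j v, w = (initialRow Λ x y z n i j).word ++ none :: v := by
  constructor
  · intro h
    induction w with
    | nil => simp [Checker.RunCount, checker] at h
    | cons l w ih =>
      obtain ⟨t, ht, h⟩ := h
      rcases l with _ | c
      · simp [checker] at ht
      · simp only [checker] at ht
        split_ifs at ht with h₁ h₂
        · obtain rfl := (Option.some.injEq _ _).mp ht
          obtain ⟨i, j, v, rfl⟩ := ih h
          exact ⟨i + 1, j, v, by
            simp only [initialRow, Row.word, List.reverse_replicate, h₁]
            rfl⟩
        · obtain rfl := (Option.some.injEq _ _).mp ht
          obtain _ | ⟨_ | c', w⟩ := w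
          · simp [Checker.RunCount, checker] at h
          · simp [Checker.RunCount, checker] at h
          · obtain ⟨t, ht, h⟩ := h
            simp only [checker, Option.ite_none_right_eq_some, Option.some.injEq] at ht
            obtain ⟨rfl, rfl⟩ := ht
            obtain ⟨j, v, rfl⟩ := runCount_counting.1 h
            exact ⟨0, j, v, by simp [initialRow, Row.word, plain, h₂]⟩
  · rintro ⟨i, j, v, rfl⟩
    simp only [initialRow, Row.word, List.reverse_replicate]
    induction i with
    | zero =>
      exact ⟨(.second, false), by simp [checker], (.counting, false), by simp [checker],
        runCount_counting.2 ⟨j, v, rfl⟩⟩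
    | succ i ih => exact ⟨(.before, false), by simp [checker], ih⟩

theorem afterSep_word (ρ : Row Γ Λ) (v : List (Letter Γ Λ)) :
    (checker M x y z).afterSep (ρ.word ++ none :: v) = v := by
  have h : ∀ u : List (Γ × Option Λ),
      (checker M x y z).afterSep (u.map some ++ none :: v) = v := fun u => by
    induction u with
    | nil => simp [Checker.afterSep, checker]
    | cons c u ih => simpa [Checker.afterSep, checker] using ih
  have hρ : ρ.word = (ρ.left.reverse.map (·, none) ++
      (ρ.head, some ρ.state) :: ρ.right.map (·, none)).map some := by
    simp [Row.word, plain, Function.comp_def]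
  rw [hρ, h]

theorem cfg_initialRow (n i j : ℕ) : (initialRow Λ x y z n i j).cfg =
    TM0.init (x :: y :: List.replicate n z) := by
  have hmk : ∀ (l : List Γ) (j : ℕ), ListBlank.mk (l ++ List.replicate j default) =
      ListBlank.mk l := fun l j => (Quotient.sound (Or.inl ⟨j, rfl⟩ : BlankRel l _)).symm
  have hl := hmk [] i
  have hr := hmk (x :: y :: List.replicate n z) j
  rw [List.nil_append] at hl
  simp only [List.cons_append] at hr
  simp only [Row.cfg, initialRow, TM0.init, hl, hr]
  rfl

theorem exists_word_iff (n : ℕ) :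
    (∃ w, (checker M x y z).RunCount (checker M x y z).count_start n w ∧
      (checker M x y z).RunCompare (checker M x y z).whole w w ∧
      (checker M x y z).RunCompare (checker M x y z).suffix w ((checker M x y z).afterSep w)) ↔
    (StateTransition.eval (TM0.step M) (TM0.init (x :: y :: List.replicate n z))).Dom := by
  constructor
  · rintro ⟨w, h₁, h₂, h₃⟩
    obtain ⟨i, j, v, rfl⟩ := runCount_before.1 h₁
    rw [afterSep_word] at h₃
    rw [← cfg_initialRow n i j]
    exact dom_eval_of_runCompare _ v h₃ h₂
  · intro h
    obtain ⟨d, hd⟩ := Part.dom_iff_mem.1 h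
    obtain ⟨h₁, h₂⟩ := StateTransition.mem_eval.1 hd
    obtain ⟨t, ht⟩ := exists_runCompare (x := x) (y := y) (z := z) h₁ h₂
    obtain ⟨v, h₃, h₄⟩ := ht (initialRow Λ x y z n t t) (cfg_initialRow n t t)
      (by simp [initialRow]) (by simp [initialRow]; omega)
    exact ⟨_, runCount_before.2 ⟨t, t, v, rfl⟩, h₄, by rwa [afterSep_word]⟩

theorem lang_eq_empty_iff {a k q : ℕ} (ha : 2 ≤ a)
    (eL : Letter Γ Λ ≃ Fin a) (eC : Checker.Common (Letter Γ Λ) RowState ≃ Fin k)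
    (eQ : CompareState Λ ≃ Fin q) (n : ℕ) :
    ((checker M x y z).table.pafa eL eC eQ ha n).lang = ∅ ↔
      ¬ (StateTransition.eval (TM0.step M) (TM0.init (x :: y :: List.replicate n z))).Dom := by
  rw [← exists_word_iff, Set.eq_empty_iff_forall_notMem, not_exists]
  refine (eL.symm.listEquivOfEquiv.forall_congr fun w => ?_)
  rw [CounterTable.mem_lang_pafa, Checker.exists_strategy_iff _ _ rfl
    (fun w' w hw h => eq_of_runCompare_seek (.inl rfl) hw h)]
  rfl

end TuringRows

/-- The emptiness problem for PAFAs is undecidable: there is no total computable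
function that, given (the natural effective encoding of) a PAFA `A` over an alphabet `Fin a`
(paired with the alphabet size `a`), decides whether the language of `A` is empty. -/
theorem emptiness_PAFA_undecidable :
    ¬ ∃ f : ℕ → Bool, Computable f ∧
        ∀ (a : ℕ) (A : PAFA (Fin a)),
          (f (Nat.pair a A.encode) = true ↔ A.lang = ∅) := by
  obtain ⟨Γ, Λ, _, _, _, _, M, x, y, z, hM⟩ := exists_undecidable_machine
  rintro ⟨f, hf, hdec⟩
  let eL := Finite.equivFin (TuringRows.Letter Γ Λ)
  let eC := Finite.equivFin (Checker.Common (TuringRows.Letter Γ Λ) TuringRows.RowState)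
  let eQ := Finite.equivFin (TuringRows.CompareState Λ)
  have ha : 2 ≤ Nat.card (TuringRows.Letter Γ Λ) := Finite.one_lt_card
  let T := (TuringRows.checker M x y z).table
  refine hM ⟨fun n => f (Nat.pair (Nat.card (TuringRows.Letter Γ Λ))
    (T.pafa eL eC eQ ha n).encode), ?_, fun n => ?_⟩
  · exact hf.comp (Primrec₂.natPair.comp (.const _)
      (T.primrec_encode_pafa eL eC eQ ha)).to_comp
  · exact (hdec _ _).trans (TuringRows.lang_eq_empty_iff ha eL eC eQ n)
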